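/- Let 0 ≤ Δ < ∞ and let G = (V,E) be a Δ-simply connected graph. Let x,y ∈ V, let β ⊆ V be a path from x to y in G, and let F ⊆ V be a finite set of vertices. If there exists a path from x to y in G ∖ F, then there exists a path γ' from x to y which is contained in (N(F,Δ) ∪ β) ∖ F, where N(F,Δ) := ⋃_{f∈F} B_G(f,Δ) is the Δ-neighborhood of F. -/

import Mathlib

/-!
STATEMENT 6 (Avoiding obstacles while staying close to them).
Let `G` be a `Δ`-simply connected graph, `β` a path from `x` to `y`, and `F` a finite
set of "forbidden" vertices. If some path from `x` to `y` avoids `F`, then there is a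
path `γ'` from `x` to `y` contained in `(N(F,Δ) ∪ β) ∖ F`.
-/

noncomputable section

variable {V : Type*}

/-- `C` is the edge set of a cycle of `G`. -/
def IsCycleSet (G : SimpleGraph V) (C : Set (Sym2 V)) : Prop :=
  ∃ (u : V) (w : G.Walk u u), w.IsCycle ∧ C = {e | e ∈ w.edges}

/-- The set of edges `C` has diameter at most `Δ`. -/
def CycleDiamLE (G : SimpleGraph V) (C : Set (Sym2 V)) (Δ : ℕ) : Prop :=
  ∀ e ∈ C, ∀ f ∈ C, ∀ x ∈ e, ∀ y ∈ f, G.dist x y ≤ Δ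

/-- `G` is `Δ`-simply connected: every cycle, viewed as an edge set, is the symmetric
difference of finitely many cycles of diameter at most `Δ`. -/
def DeltaSimplyConnected (G : SimpleGraph V) (Δ : ℕ) : Prop :=
  ∀ (u : V) (w : G.Walk u u), w.IsCycle →
    ∃ L : List (Set (Sym2 V)),
      (∀ C ∈ L, IsCycleSet G C ∧ CycleDiamLE G C Δ) ∧
      {e | e ∈ w.edges} = L.foldr (fun A B => symmDiff A B) ∅

/-- The sum modulo `2` of the edges of a walk. -/
def edgeChain {G : SimpleGraph V} {u v : V} (w : G.Walk u v) : Sym2 V →₀ ZMod 2 :=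
  (w.edges.map fun e => Finsupp.single e 1).sum

lemma sum_map_single_apply (l : List (Sym2 V)) (hl : l.Nodup) (e : Sym2 V) :
    (l.map fun e => Finsupp.single e (1 : ZMod 2)).sum e = 1 ↔ e ∈ l := by
  classical
  have key : (l.map fun e => Finsupp.single e (1 : ZMod 2)).sum e = (l.count e : ZMod 2) := by
    clear hl
    induction l with
    | nil => simp
    | cons a l ih =>
      simp only [List.map_cons, List.sum_cons, Finsupp.add_apply, ih, List.count_cons,
        Finsupp.single_apply, beq_iff_eq]
      split_ifs <;> push_cast <;> ring
  rw [key, hl.count]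
  split_ifs with h <;> simp [h]

lemma edgeChain_apply_of_nodup {G : SimpleGraph V} {u v : V} {w : G.Walk u v}
    (hw : w.edges.Nodup) (e : Sym2 V) : edgeChain w e = 1 ↔ e ∈ w.edges :=
  sum_map_single_apply _ hw e

lemma edgeChain_nil {G : SimpleGraph V} {u : V} :
    edgeChain (SimpleGraph.Walk.nil : G.Walk u u) = 0 := by
  simp [edgeChain]

lemma edgeChain_cons {G : SimpleGraph V} {u v t : V} (h : G.Adj u v) (w : G.Walk v t) :
    edgeChain (SimpleGraph.Walk.cons h w) = Finsupp.single s(u, v) 1 + edgeChain w := by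
  simp [edgeChain]

lemma edgeChain_append {G : SimpleGraph V} {u v t : V} (p : G.Walk u v) (q : G.Walk v t) :
    edgeChain (p.append q) = edgeChain p + edgeChain q := by
  simp [edgeChain]

lemma edgeChain_reverse {G : SimpleGraph V} {u v : V} (p : G.Walk u v) :
    edgeChain p.reverse = edgeChain p := by
  simp [edgeChain, List.sum_reverse]

lemma edgeChain_mem_supported {G : SimpleGraph V} {u v : V} (w : G.Walk u v)
    {S : Set (Sym2 V)} (h : ∀ e ∈ w.edges, e ∈ S) :
    edgeChain w ∈ Finsupp.supported (ZMod 2) (ZMod 2) S := by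
  refine list_sum_mem fun c hc => ?_
  obtain ⟨e, he, rfl⟩ := List.mem_map.1 hc
  exact Finsupp.single_mem_supported _ _ (h e he)

lemma chain_add_self (c : Sym2 V →₀ ZMod 2) : c + c = 0 := by
  ext e
  exact CharTwo.add_self_eq_zero _

lemma chain_ext {c d : Sym2 V →₀ ZMod 2} (h : ∀ e, c e = 1 ↔ d e = 1) : c = d := by
  have key : ∀ a b : ZMod 2, (a = 1 ↔ b = 1) → a = b := by decide
  ext e
  rw [key _ _ (h e)]

/-- The number modulo `2` of edges of a chain having exactly one endpoint in `K`. -/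
def crossing (K : Set V) : (Sym2 V →₀ ZMod 2) →ₗ[ZMod 2] ZMod 2 :=
  Finsupp.linearCombination (ZMod 2)
    (Sym2.lift ⟨fun a b => K.indicator 1 a + K.indicator 1 b, fun _ _ => add_comm _ _⟩)

lemma crossing_edgeChain (K : Set V) {G : SimpleGraph V} {u v : V} (w : G.Walk u v) :
    crossing K (edgeChain w) = K.indicator 1 u + K.indicator 1 v := by
  induction w with
  | nil => rw [edgeChain_nil, map_zero, CharTwo.add_self_eq_zero]
  | @cons a b c h p ih =>
    rw [edgeChain_cons, map_add, ih]
    simp only [crossing, Finsupp.linearCombination_single, Sym2.lift_mk, one_smul]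
    linear_combination CharTwo.add_self_eq_zero (K.indicator (1 : V → ZMod 2) b)

lemma crossing_eq_zero_of_mem_supported (K : Set V) {S : Set (Sym2 V)}
    (hS : ∀ a b, s(a, b) ∈ S → (a ∈ K ↔ b ∈ K)) {c : Sym2 V →₀ ZMod 2}
    (hc : c ∈ Finsupp.supported (ZMod 2) (ZMod 2) S) : crossing K c = 0 := by
  classical
  rw [crossing, Finsupp.linearCombination_apply]
  refine Finset.sum_eq_zero fun e he => ?_
  have heS : e ∈ S := hc he
  induction e using Sym2.ind with
  | _ a b =>
    have hab : K.indicator (1 : V → ZMod 2) a = K.indicator 1 b := by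
      simp only [Set.indicator_apply, hS a b heS, Pi.one_apply]
    simp only [Sym2.lift_mk, hab, CharTwo.add_self_eq_zero, smul_zero]

/-- The edge chains of the cycles of diameter at most `Δ` whose vertex set satisfies `P`. -/
def smallCycleChains (G : SimpleGraph V) (Δ : ℕ) (P : Set V → Prop) : Set (Sym2 V →₀ ZMod 2) :=
  {c | ∃ (u : V) (w : G.Walk u u), w.IsCycle ∧ CycleDiamLE G {e | e ∈ w.edges} Δ ∧
    P {z | z ∈ w.support} ∧ c = edgeChain w}

lemma exists_mem_span_of_list (G : SimpleGraph V) (Δ : ℕ) (L : List (Set (Sym2 V)))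
    (hL : ∀ C ∈ L, IsCycleSet G C ∧ CycleDiamLE G C Δ) :
    ∃ c ∈ Submodule.span (ZMod 2) (smallCycleChains G Δ fun _ => True),
      ∀ e, c e = 1 ↔ e ∈ L.foldr (fun A B => symmDiff A B) ∅ := by
  induction L with
  | nil => exact ⟨0, Submodule.zero_mem _, by simp⟩
  | cons C L ih =>
    obtain ⟨c, hc, hce⟩ := ih fun D hD => hL D (List.mem_cons_of_mem _ hD)
    obtain ⟨⟨u, w, hw, rfl⟩, hd⟩ := hL C List.mem_cons_self
    refine ⟨edgeChain w + c,
      Submodule.add_mem _ (Submodule.subset_span ⟨u, w, hw, hd, trivial, rfl⟩) hc, fun e => ?_⟩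
    have key : ∀ a b : ZMod 2, a + b = 1 ↔ (a = 1 ∧ ¬ b = 1) ∨ (b = 1 ∧ ¬ a = 1) := by decide
    rw [List.foldr_cons, Set.mem_symmDiff, Finsupp.add_apply, key, hce,
      edgeChain_apply_of_nodup hw.edges_nodup, Set.mem_ofPred_eq]

lemma edgeChain_mem_span_of_isCycle {G : SimpleGraph V} {Δ : ℕ} (hG : DeltaSimplyConnected G Δ)
    {u : V} {w : G.Walk u u} (hw : w.IsCycle) :
    edgeChain w ∈ Submodule.span (ZMod 2) (smallCycleChains G Δ fun _ => True) := by
  obtain ⟨L, hL, hwL⟩ := hG u w hw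
  obtain ⟨c, hc, hce⟩ := exists_mem_span_of_list G Δ L hL
  convert hc
  refine chain_ext fun e => ?_
  rw [hce, ← hwL, edgeChain_apply_of_nodup hw.edges_nodup, Set.mem_ofPred_eq]

/-- A path closed up by an edge is a cycle, or traverses that edge back and forth. -/
lemma edgeChain_cons_mem_span_of_isPath {G : SimpleGraph V} {Δ : ℕ}
    (hG : DeltaSimplyConnected G Δ) {u v : V} (h : G.Adj u v) {p : G.Walk v u} (hp : p.IsPath) :
    edgeChain (SimpleGraph.Walk.cons h p) ∈
      Submodule.span (ZMod 2) (smallCycleChains G Δ fun _ => True) := by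
  by_cases he : s(u, v) ∈ p.edges
  · cases p with
    | nil => exact absurd rfl h.ne
    | @cons _ b _ h' q =>
      rw [SimpleGraph.Walk.cons_isPath_iff] at hp
      rw [SimpleGraph.Walk.edges_cons, List.mem_cons] at he
      have hub : u = b := by
        rcases he with he | he
        · rw [Sym2.eq_swap] at he
          exact Sym2.congr_right.1 he
        · exact absurd (q.snd_mem_support_of_mem_edges he) hp.2
      subst hub
      rw [SimpleGraph.Walk.isPath_iff_nil] at hp
      rw [hp.1.eq_nil, edgeChain_cons, edgeChain_cons, edgeChain_nil, add_zero, Sym2.eq_swap,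
        chain_add_self]
      exact Submodule.zero_mem _
  · exact edgeChain_mem_span_of_isCycle hG ((SimpleGraph.Walk.cons_isCycle_iff p h).2 ⟨hp, he⟩)

open Classical in
lemma edgeChain_add_edgeChain_bypass_mem_span {G : SimpleGraph V} {Δ : ℕ}
    (hG : DeltaSimplyConnected G Δ) {u v : V} (w : G.Walk u v) :
    edgeChain w + edgeChain w.bypass ∈
      Submodule.span (ZMod 2) (smallCycleChains G Δ fun _ => True) := by
  induction w with
  | nil => simp [SimpleGraph.Walk.bypass, edgeChain_nil]
  | @cons a b c h p ih =>
    rw [SimpleGraph.Walk.bypass]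
    split_ifs with hs
    · have hcyc := edgeChain_cons_mem_span_of_isPath hG h
        (p.bypass_isPath.takeUntil hs)
      have hsplit : edgeChain p.bypass =
          edgeChain (p.bypass.takeUntil a hs) + edgeChain (p.bypass.dropUntil a hs) := by
        rw [← edgeChain_append, SimpleGraph.Walk.take_spec]
      convert Submodule.add_mem _ hcyc ih using 1
      rw [edgeChain_cons, edgeChain_cons, hsplit]
      linear_combination (norm := module) -chain_add_self (edgeChain (p.bypass.takeUntil a hs))
    · convert ih using 1
      rw [edgeChain_cons, edgeChain_cons]
      linear_combination (norm := module) chain_add_self (Finsupp.single s(a, b) (1 : ZMod 2))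

lemma edgeChain_mem_span_of_closed {G : SimpleGraph V} {Δ : ℕ} (hG : DeltaSimplyConnected G Δ)
    {u : V} (w : G.Walk u u) :
    edgeChain w ∈ Submodule.span (ZMod 2) (smallCycleChains G Δ fun _ => True) := by
  classical
  have h := edgeChain_add_edgeChain_bypass_mem_span hG w
  rwa [(SimpleGraph.Walk.isPath_iff_nil.1 w.bypass_isPath).eq_nil, edgeChain_nil, add_zero] at h

lemma smallCycleChains_true_subset_union (G : SimpleGraph V) (Δ : ℕ) (P : Set V → Prop) :
    smallCycleChains G Δ (fun _ => True) ⊆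
      smallCycleChains G Δ P ∪ smallCycleChains G Δ fun S => ¬ P S := by
  rintro c ⟨u, w, hw, hd, -, rfl⟩
  by_cases h : P {z | z ∈ w.support}
  · exact Or.inl ⟨u, w, hw, hd, h, rfl⟩
  · exact Or.inr ⟨u, w, hw, hd, h, rfl⟩

lemma crossing_eq_zero_of_mem_span {G : SimpleGraph V} {Δ : ℕ} {P : Set V → Prop} (K : Set V)
    {c : Sym2 V →₀ ZMod 2} (hc : c ∈ Submodule.span (ZMod 2) (smallCycleChains G Δ P)) :
    crossing K c = 0 := by
  refine (Submodule.span_le (p := LinearMap.ker (crossing K))).2 ?_ hc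
  rintro _ ⟨u, w, -, -, -, rfl⟩
  exact (crossing_edgeChain K w).trans (CharTwo.add_self_eq_zero _)

lemma span_smallCycleChains_meeting_le (G : SimpleGraph V) (Δ : ℕ) (F : Set V) :
    Submodule.span (ZMod 2) (smallCycleChains G Δ fun S => (F ∩ S).Nonempty) ≤
      Finsupp.supported (ZMod 2) (ZMod 2)
        {e | e ∈ G.edgeSet ∧ ∀ z ∈ e, ∃ f ∈ F, G.dist f z ≤ Δ} := by
  rw [Submodule.span_le]
  rintro _ ⟨u, w, hw, hd, ⟨f, hfF, hfw⟩, rfl⟩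
  refine edgeChain_mem_supported w fun e he => ⟨w.edges_subset_edgeSet he, fun z hz => ?_⟩
  obtain ⟨e', he', hfe'⟩ :=
    (SimpleGraph.Walk.mem_support_iff_exists_mem_edges_of_not_nil hw.not_nil).1 hfw
  exact ⟨f, hfF, hd e' he' e he f hfe' z hz⟩

lemma span_smallCycleChains_avoiding_le (G : SimpleGraph V) (Δ : ℕ) (F : Set V) :
    Submodule.span (ZMod 2) (smallCycleChains G Δ fun S => ¬ (F ∩ S).Nonempty) ≤
      Finsupp.supported (ZMod 2) (ZMod 2) {e | ∀ z ∈ e, z ∉ F} := by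
  rw [Submodule.span_le]
  rintro _ ⟨u, w, -, -, hF, rfl⟩
  refine edgeChain_mem_supported w fun e he z hz hzF => hF ⟨z, hzF, ?_⟩
  exact w.mem_support_of_mem_edges he hz

/-- A chain with boundary `x + y` supported on edges inside `A` connects `x` to `y` in `A`. -/
lemma exists_walk_of_mem_supported {G : SimpleGraph V} {x y : V} {A : Set V} (hx : x ∈ A)
    {c : Sym2 V →₀ ZMod 2}
    (hc : c ∈ Finsupp.supported (ZMod 2) (ZMod 2) {e | e ∈ G.edgeSet ∧ ∀ z ∈ e, z ∈ A})
    (hcross : ∀ K : Set V,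
      crossing K c = K.indicator (1 : V → ZMod 2) x + K.indicator (1 : V → ZMod 2) y) :
    ∃ w : G.Walk x y, ∀ z ∈ w.support, z ∈ A := by
  set K : Set V := {v | ∃ w : G.Walk x v, ∀ z ∈ w.support, z ∈ A}
  have hstep : ∀ a b, G.Adj a b → b ∈ A → a ∈ K → b ∈ K := by
    rintro a b hab hb ⟨w, hw⟩
    refine ⟨w.concat hab, fun z hz => ?_⟩
    rw [SimpleGraph.Walk.support_concat, List.mem_append, List.mem_singleton] at hz
    rcases hz with hz | rfl
    · exact hw z hz
    · exact hb
  have hzero : crossing K c = 0 := by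
    refine crossing_eq_zero_of_mem_supported K (fun a b hab => ?_) hc
    exact ⟨hstep a b hab.1 (hab.2 b (Sym2.mem_mk_right a b)),
      hstep b a hab.1.symm (hab.2 a (Sym2.mem_mk_left a b))⟩
  have hxK : x ∈ K := ⟨SimpleGraph.Walk.nil, by simpa using hx⟩
  by_contra hyK
  change y ∉ K at hyK
  have h := hcross K
  rw [hzero, Set.indicator_of_mem hxK, Set.indicator_of_notMem hyK] at h
  simp at h

theorem avoid_obstacles
    (G : SimpleGraph V) (Δ : ℕ) (hG : DeltaSimplyConnected G Δ)
    (x y : V) (β : G.Walk x y) (hβ : β.IsPath)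
    (F : Set V) (hF : F.Finite)
    (γ : G.Walk x y) (hγp : γ.IsPath) (hγ : ∀ z ∈ γ.support, z ∉ F) :
    ∃ γ' : G.Walk x y, γ'.IsPath ∧
      ∀ z ∈ γ'.support,
        ((∃ f ∈ F, G.dist f z ≤ Δ) ∨ z ∈ β.support) ∧ z ∉ F := by
  classical
  have hz := edgeChain_mem_span_of_closed hG (β.append γ.reverse)
  rw [edgeChain_append, edgeChain_reverse] at hz
  replace hz := Submodule.span_mono
    (smallCycleChains_true_subset_union G Δ fun S => (F ∩ S).Nonempty) hz
  rw [Submodule.span_union] at hz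
  obtain ⟨s, hs, t, ht, hst⟩ := Submodule.mem_sup.1 hz
  have hst' : edgeChain β + s = edgeChain γ + t := by
    linear_combination (norm := module) -hst + chain_add_self s - chain_add_self (edgeChain γ)
  set N : Set V := {z | (∃ f ∈ F, G.dist f z ≤ Δ) ∨ z ∈ β.support}
  have hnear : edgeChain β + s ∈ Finsupp.supported (ZMod 2) (ZMod 2)
      {e | e ∈ G.edgeSet ∧ ∀ z ∈ e, z ∈ N} := by
    refine Submodule.add_mem _ (edgeChain_mem_supported β fun e he => ?_)
      (Finsupp.supported_mono ?_ (span_smallCycleChains_meeting_le G Δ F hs))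
    · exact ⟨β.edges_subset_edgeSet he, fun z hz => Or.inr (β.mem_support_of_mem_edges he hz)⟩
    · exact fun e he => ⟨he.1, fun z hz => Or.inl (he.2 z hz)⟩
  have havoid : edgeChain β + s ∈ Finsupp.supported (ZMod 2) (ZMod 2)
      {e | ∀ z ∈ e, z ∉ F} := by
    rw [hst']
    exact Submodule.add_mem _
      (edgeChain_mem_supported γ fun e he z hz => hγ z (γ.mem_support_of_mem_edges he hz))
      (span_smallCycleChains_avoiding_le G Δ F ht)
  obtain ⟨w, hw⟩ := exists_walk_of_mem_supported (G := G) (y := y) (A := N \ F)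
    ⟨Or.inr β.start_mem_support, hγ x γ.start_mem_support⟩
    (c := edgeChain β + s)
    (fun e he => ⟨(hnear he).1, fun z hz => ⟨(hnear he).2 z hz, havoid he z hz⟩⟩)
    (fun K => by
      rw [map_add, crossing_eq_zero_of_mem_span K hs, add_zero, crossing_edgeChain])
  exact ⟨w.bypass, w.bypass_isPath, fun z hz => hw z (w.support_bypass_subset_support hz)⟩
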